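/- arXiv:2309.08874 — 2 statements merged into one kernel-verified Lean document; each statement's English description precedes it below -/
import Mathlib

section
/- Let 𝔤 be a Lie algebra over a field k of characteristic zero, and let κ be a nondegenerate invariant bilinear form on 𝔤. Let h, f ∈ 𝔤 with ⁅h, f⁆ = (-2) • f, and suppose 𝔤 is the internal direct sum of the ad(h)-eigenspaces 𝔤_j = {x ∈ 𝔤 : ⁅h,x⁆ = j • x} for j ranging over the integers (cast into k). Suppose moreover that ad(f) restricted to 𝔤_1 is injective. Then the bilinear form κ_1 on 𝔤_1 defined by κ_1(v, w) := κ(f, ⁅v, w⁆) is alternating and nondegenerate; i.e. κ_1 is a symplectic form on 𝔤_1. -/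
/-- For an invariant form, `ad h`-eigenspaces with eigenvalues `a`, `b` are orthogonal unless
`a + b = 0`. -/
theorem LieAlgebra.invariant_form_eq_zero_of_mem_eigenspace
    {k L : Type*} [Field k] [LieRing L] [LieAlgebra k L] {κ : L →ₗ[k] L →ₗ[k] k}
    (hinv : ∀ x y z : L, κ ⁅x, y⁆ z = κ x ⁅y, z⁆) {h x y : L} {a b : k}
    (hx : ⁅h, x⁆ = a • x) (hy : ⁅h, y⁆ = b • y) (hab : a + b ≠ 0) : κ x y = 0 := by
  have hxy := hinv x h y
  rw [← lie_skew, hx, hy] at hxy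
  simp only [map_neg, map_smul, LinearMap.neg_apply, LinearMap.smul_apply, smul_eq_mul] at hxy
  exact (mul_eq_zero.mp (by linear_combination -hxy : (a + b) * κ x y = 0)).resolve_left hab


/-- Let `κ` be a nondegenerate invariant bilinear form on a Lie algebra `L` over a field of
characteristic zero, let `h, f` satisfy `⁅h, f⁆ = (-2) • f`, and suppose `L` is the internal
direct sum of the `ad h`-eigenspaces for integer eigenvalues.  If `ad f` is injective on the
`1`-eigenspace `L₁`, then the form `κ₁(v, w) := κ f ⁅v, w⁆` on `L₁` is alternating and
nondegenerate, i.e. a symplectic form on `L₁`. -/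
theorem kappa_one_is_symplectic
    {k L : Type*} [Field k] [CharZero k] [LieRing L] [LieAlgebra k L]
    (κ : L →ₗ[k] L →ₗ[k] k)
    (hinv : ∀ x y z : L, κ ⁅x, y⁆ z = κ x ⁅y, z⁆)
    (hnd : ∀ v : L, (∀ x : L, κ v x = 0) → v = 0)
    (h f : L) (hhf : ⁅h, f⁆ = (-2 : k) • f)
    (hdecomp : DirectSum.IsInternal
      (fun j : ℤ => Module.End.eigenspace (LieAlgebra.ad k L h) (j : k)))
    (hinj : ∀ v ∈ Module.End.eigenspace (LieAlgebra.ad k L h) ((1 : ℤ) : k),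
      ⁅f, v⁆ = 0 → v = 0) :
    (∀ v ∈ Module.End.eigenspace (LieAlgebra.ad k L h) ((1 : ℤ) : k), κ f ⁅v, v⁆ = 0) ∧
    (∀ v ∈ Module.End.eigenspace (LieAlgebra.ad k L h) ((1 : ℤ) : k),
      (∀ w ∈ Module.End.eigenspace (LieAlgebra.ad k L h) ((1 : ℤ) : k), κ f ⁅v, w⁆ = 0) →
      v = 0) := by
  refine ⟨fun v _ => by simp, fun v hv hvw => hinj v hv (hnd _ fun x => ?_)⟩
  have hv' : ⁅h, v⁆ = (1 : k) • v := by simpa [Module.End.mem_eigenspace_iff] using hv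
  have hfv : ⁅h, ⁅f, v⁆⁆ = (-1 : k) • ⁅f, v⁆ := by
    rw [leibniz_lie, hhf, hv', smul_lie, lie_smul, ← add_smul]
    norm_num
  have hx : x ∈ ⨆ j : ℤ, Module.End.eigenspace (LieAlgebra.ad k L h) (j : k) := by
    simp [hdecomp.submodule_iSup_eq_top]
  induction hx using Submodule.iSup_induction' with
  | mem j y hy =>
    by_cases hj : j = 1
    · subst hj
      rw [hinv]
      exact hvw y hy
    · refine LieAlgebra.invariant_form_eq_zero_of_mem_eigenspace hinv hfv
        (by simpa [Module.End.mem_eigenspace_iff] using hy) fun hsum => hj ?_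
      exact_mod_cast (by linear_combination hsum : (j : k) = 1)
  | zero => simp
  | add y z _ _ hy hz => simp [hy, hz]
end

section
/- Let k be a field, V a finite-dimensional k-vector space, and B a nondegenerate reflexive bilinear form on V (e.g. symmetric or alternating). Let W be a k-vector space and f : V → W a linear map such that the restriction of B to K := ker f is nondegenerate. Then: (i) every B-isometry g of V satisfying f ∘ g = f maps K into itself and fixes the orthogonal complement K^⊥ = {v ∈ V : B(v, u) = 0 for all u ∈ K} pointwise; and (ii) restriction to K, g ↦ g|_K, defines a group isomorphism from the group {g a B-isometry of V : f ∘ g = f} onto the group of isometries of (K, B|_K). -/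
/-- The subgroup of `B`-isometries of `V`. -/
def isometrySubgroup {k V : Type*} [Field k] [AddCommGroup V] [Module k V]
    (B : LinearMap.BilinForm k V) : Subgroup (V ≃ₗ[k] V) where
  carrier := {g | ∀ v w : V, B (g v) (g w) = B v w}
  one_mem' := by intro v w; rfl
  mul_mem' := by
    intro g h hg hh v w
    show B (g (h v)) (g (h w)) = B v w
    rw [hg, hh]
  inv_mem' := by
    intro g hg v w
    show B (g.symm v) (g.symm w) = B v w
    conv_rhs => rw [← g.apply_symm_apply v, ← g.apply_symm_apply w, hg]

/-- The subgroup of `B`-isometries `g` of `V` satisfying `f ∘ g = f`. -/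
def isometryStabilizer {k V W : Type*} [Field k] [AddCommGroup V] [Module k V]
    [AddCommGroup W] [Module k W]
    (B : LinearMap.BilinForm k V) (f : V →ₗ[k] W) : Subgroup (V ≃ₗ[k] V) where
  carrier := {g | (∀ v w : V, B (g v) (g w) = B v w) ∧ ∀ v : V, f (g v) = f v}
  one_mem' := ⟨fun _ _ => rfl, fun _ => rfl⟩
  mul_mem' := by
    rintro g h ⟨hg1, hg2⟩ ⟨hh1, hh2⟩
    refine ⟨fun v w => ?_, fun v => ?_⟩
    · show B (g (h v)) (g (h w)) = B v w
      rw [hg1, hh1]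
    · show f (g (h v)) = f v
      rw [hg2, hh2]
  inv_mem' := by
    rintro g ⟨hg1, hg2⟩
    refine ⟨fun v w => ?_, fun v => ?_⟩
    · show B (g.symm v) (g.symm w) = B v w
      conv_rhs => rw [← g.apply_symm_apply v, ← g.apply_symm_apply w, hg1]
    · show f (g.symm v) = f v
      conv_rhs => rw [← g.apply_symm_apply v, hg2]

section Helpers

variable {k V W : Type*} [Field k] [AddCommGroup V] [Module k V]
  [AddCommGroup W] [Module k W] {B : LinearMap.BilinForm k V} {f : V →ₗ[k] W}

theorem mem_ker_apply_iff_of_mem_isometryStabilizer {g : V ≃ₗ[k] V}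
    (hg : g ∈ isometryStabilizer B f) (x : V) :
    g x ∈ LinearMap.ker f ↔ x ∈ LinearMap.ker f := by
  rw [LinearMap.mem_ker, LinearMap.mem_ker, hg.2]

theorem apply_eq_self_of_mem_isometryStabilizer
    (hndK : (B.restrict (LinearMap.ker f)).Nondegenerate) {g : V ≃ₗ[k] V}
    (hg : g ∈ isometryStabilizer B f) {v : V} (hv : ∀ u ∈ LinearMap.ker f, B v u = 0) :
    g v = v := by
  have hmem : g v - v ∈ LinearMap.ker f := by
    rw [LinearMap.mem_ker, map_sub, hg.2, sub_self]
  have hzero : (⟨g v - v, hmem⟩ : LinearMap.ker f) = 0 := by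
    refine hndK.1 _ fun u => ?_
    have hu : g.symm u ∈ LinearMap.ker f := by
      rw [← mem_ker_apply_iff_of_mem_isometryStabilizer hg, g.apply_symm_apply]
      exact u.2
    have hgu : B (g v) u = 0 := by
      rw [← g.apply_symm_apply (u : V), hg.1]
      exact hv _ hu
    show B (g v - v) u = 0
    rw [map_sub, LinearMap.sub_apply, hgu, hv _ u.2, sub_zero]
  exact sub_eq_zero.mp (congrArg Subtype.val hzero)

/-- Restriction to `ker f`, as a homomorphism from the stabilizer of `f` to the isometry group
of `ker f`. -/
def isometryStabilizerRestrict (B : LinearMap.BilinForm k V) (f : V →ₗ[k] W) :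
    isometryStabilizer B f →* isometrySubgroup (B.restrict (LinearMap.ker f)) where
  toFun g :=
    ⟨g.1.ofSubmodules (LinearMap.ker f) (LinearMap.ker f) (by
        ext x
        rw [Submodule.mem_map_equiv, ← mem_ker_apply_iff_of_mem_isometryStabilizer g.2,
          g.1.apply_symm_apply]),
      fun v w => g.2.1 v w⟩
  map_one' := rfl
  map_mul' _ _ := rfl

/-- Extension by the identity on a complement `q` of a linear automorphism of `p`. -/
noncomputable def extendOfIsCompl {p q : Submodule k V} (hpq : IsCompl p q) (h : p ≃ₗ[k] p) :
    V ≃ₗ[k] V :=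
  (Submodule.prodEquivOfIsCompl p q hpq).symm ≪≫ₗ
    (h.prodCongr (LinearEquiv.refl k q)) ≪≫ₗ Submodule.prodEquivOfIsCompl p q hpq

theorem extendOfIsCompl_apply_add {p q : Submodule k V} (hpq : IsCompl p q) (h : p ≃ₗ[k] p)
    (x : p) (y : q) : extendOfIsCompl hpq h (x + y) = h x + y := by
  have hxy : (Submodule.prodEquivOfIsCompl p q hpq).symm (x + y) = (x, y) := by
    rw [LinearEquiv.symm_apply_eq, Submodule.coe_prodEquivOfIsCompl']
  simp [extendOfIsCompl, -map_add, hxy]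

theorem exists_add_of_isCompl {p q : Submodule k V} (hpq : IsCompl p q) (v : V) :
    ∃ (x : p) (y : q), v = x + y :=
  ⟨_, _, ((Submodule.prodEquivOfIsCompl p q hpq).apply_symm_apply v).symm⟩

theorem extendOfIsCompl_mem_isometryStabilizer (hB : B.IsRefl)
    (hc : IsCompl (LinearMap.ker f) (B.orthogonal (LinearMap.ker f)))
    {h : LinearMap.ker f ≃ₗ[k] LinearMap.ker f}
    (hh : h ∈ isometrySubgroup (B.restrict (LinearMap.ker f))) :
    extendOfIsCompl hc h ∈ isometryStabilizer B f := by
  refine ⟨fun v w => ?_, fun v => ?_⟩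
  · obtain ⟨x, y, rfl⟩ := exists_add_of_isCompl hc v
    obtain ⟨x', y', rfl⟩ := exists_add_of_isCompl hc w
    have hleft (a : LinearMap.ker f) (b : B.orthogonal (LinearMap.ker f)) :
        B (a : V) (b : V) = 0 := b.2 a a.2
    have hright (a : LinearMap.ker f) (b : B.orthogonal (LinearMap.ker f)) :
        B (b : V) (a : V) = 0 := hB _ _ (hleft a b)
    have hx : B (h x : V) (h x' : V) = B (x : V) (x' : V) := hh x x'
    rw [extendOfIsCompl_apply_add, extendOfIsCompl_apply_add]
    simp only [map_add, LinearMap.add_apply, hleft, hright, hx]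
  · obtain ⟨x, y, rfl⟩ := exists_add_of_isCompl hc v
    rw [extendOfIsCompl_apply_add, map_add, map_add, LinearMap.mem_ker.mp (h x).2,
      LinearMap.mem_ker.mp x.2]

theorem isometryStabilizerRestrict_bijective [FiniteDimensional k V] (hB : B.IsRefl)
    (hndK : (B.restrict (LinearMap.ker f)).Nondegenerate) :
    Function.Bijective (isometryStabilizerRestrict B f) := by
  have hc := LinearMap.BilinForm.isCompl_orthogonal_of_restrict_nondegenerate hB hndK
  refine ⟨fun g g' hgg' => ?_, fun h => ?_⟩
  · ext v
    obtain ⟨x, y, rfl⟩ := exists_add_of_isCompl hc v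
    have hy : ∀ u ∈ LinearMap.ker f, B (y : V) u = 0 := fun u hu => hB _ _ (y.2 u hu)
    have hx : g.1 (x : V) = g'.1 (x : V) :=
      congrArg (fun h => (h.1 x : V)) hgg'
    rw [map_add, map_add, hx, apply_eq_self_of_mem_isometryStabilizer hndK g.2 hy,
      apply_eq_self_of_mem_isometryStabilizer hndK g'.2 hy]
  · refine ⟨⟨extendOfIsCompl hc h.1, extendOfIsCompl_mem_isometryStabilizer hB hc h.2⟩, ?_⟩
    ext x
    show extendOfIsCompl hc h.1 (x : V) = h.1 x
    simpa using extendOfIsCompl_apply_add hc h.1 x 0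

end Helpers

/-- Let `B` be a nondegenerate reflexive bilinear form on a finite-dimensional space `V`,
and `f : V →ₗ W` a linear map whose kernel `K` carries a nondegenerate restricted form.
Then (i) every `B`-isometry `g` with `f ∘ g = f` maps `K` to itself and fixes `K^⊥`
pointwise, and (ii) restriction to `K` is a group isomorphism from the stabilizer
`{g : f ∘ g = f}` inside the isometry group of `(V, B)` onto the isometry group of
`(K, B|_K)`. -/
theorem stabilizer_of_linear_map_is_isometry_group_of_kernel
    {k V W : Type*} [Field k] [AddCommGroup V] [Module k V] [FiniteDimensional k V]
    [AddCommGroup W] [Module k W]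
    (B : LinearMap.BilinForm k V)
    (hrefl : ∀ v w : V, B v w = 0 → B w v = 0)
    (hnd : B.Nondegenerate)
    (f : V →ₗ[k] W)
    (hndK : (B.restrict (LinearMap.ker f)).Nondegenerate) :
    (∀ g : V ≃ₗ[k] V, g ∈ isometryStabilizer B f →
      (∀ x ∈ LinearMap.ker f, g x ∈ LinearMap.ker f) ∧
      (∀ v : V, (∀ u ∈ LinearMap.ker f, B v u = 0) → g v = v)) ∧
    ∃ e : isometryStabilizer B f ≃* isometrySubgroup (B.restrict (LinearMap.ker f)),
      ∀ (g : isometryStabilizer B f) (x : LinearMap.ker f),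
        ((e g).val x : V) = g.val (x : V) :=
  ⟨fun _ hg => ⟨fun x => (mem_ker_apply_iff_of_mem_isometryStabilizer hg x).mpr,
      fun _ => apply_eq_self_of_mem_isometryStabilizer hndK hg⟩,
    MulEquiv.ofBijective _ (isometryStabilizerRestrict_bijective hrefl hndK), fun _ _ => rfl⟩
end
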